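/- (Continuity of the bilinear form, unbounded case.) Let Ω ⊆ ℝ³ be an open set (possibly unbounded), and let a₁, a₂, a₃ : Ω → ℝ be of class C^m such that a_l and every partial derivative ∂^b a_l with |b| ≤ m are bounded on Ω. Then for every s ∈ ℍ there exists a constant C(s) > 0 such that for all u, v ∈ C_c^∞(Ω, ℂ⊗ℍ): |⟨Q_s(T) u, v⟩_{L²}| ≤ C(s) ‖u‖_{H^m} ‖v‖_{H^m}, where |·| on the left is the quaternionic modulus. -/

import Mathlib

noncomputable section

open MeasureTheory Finset

/-- The quaternions ℍ. -/
abbrev HQ : Type := Quaternion ℝ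

/-- The complexified quaternions ℂ⊗ℍ, modelled as pairs (u₁, u₂) representing u₁ + i u₂. -/
abbrev CH : Type := HQ × HQ

/-- Euclidean three-space. -/
abbrev E3 : Type := EuclideanSpace ℝ (Fin 3)

/-- The imaginary units e₁, e₂, e₃ of ℍ. -/
def qe : Fin 3 → HQ := ![⟨0,1,0,0⟩, ⟨0,0,1,0⟩, ⟨0,0,0,1⟩]

/-- Multiplication by the complex imaginary unit i on ℂ⊗ℍ : (u₁,u₂) ↦ (−u₂,u₁). -/
def Ci (u : CH) : CH := (-u.2, u.1)

/-- Left multiplication of an element of ℂ⊗ℍ by a quaternion. -/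
def lmul (p : HQ) (u : CH) : CH := (p * u.1, p * u.2)

/-- Right multiplication of an element of ℂ⊗ℍ by a quaternion. -/
def rmul (u : CH) (p : HQ) : CH := (u.1 * p, u.2 * p)

/-- The ℍ-valued inner product ⟨u,v⟩ = conj(u₁)v₁ + conj(u₂)v₂ on ℂ⊗ℍ. -/
def qip (u v : CH) : HQ := star u.1 * v.1 + star u.2 * v.2

/-- The squared modulus |u|² = |u₁|² + |u₂|² on ℂ⊗ℍ. -/
def qmodSq (u : CH) : ℝ := ‖u.1‖ ^ 2 + ‖u.2‖ ^ 2

/-- Partial derivative within Ω in the l-th coordinate direction (ℂ⊗ℍ-valued). -/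
def pdW (Ω : Set E3) (l : Fin 3) (f : E3 → CH) : E3 → CH :=
  fun x => fderivWithin ℝ f Ω x (EuclideanSpace.single l 1)

/-- Partial derivative within Ω in the l-th coordinate direction (real-valued). -/
def pdWR (Ω : Set E3) (l : Fin 3) (f : E3 → ℝ) : E3 → ℝ :=
  fun x => fderivWithin ℝ f Ω x (EuclideanSpace.single l 1)

/-- Mixed partial derivative ∂^b within Ω, for a multi-index b ∈ ℕ³ (ℂ⊗ℍ-valued). -/
def pdMulti (Ω : Set E3) (b : Fin 3 → ℕ) (u : E3 → CH) : E3 → CH :=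
  (pdW Ω 0)^[b 0] ((pdW Ω 1)^[b 1] ((pdW Ω 2)^[b 2] u))

/-- Mixed partial derivative ∂^b within Ω, for a multi-index b ∈ ℕ³ (real-valued). -/
def pdMultiR (Ω : Set E3) (b : Fin 3 → ℕ) (u : E3 → ℝ) : E3 → ℝ :=
  (pdWR Ω 0)^[b 0] ((pdWR Ω 1)^[b 1] ((pdWR Ω 2)^[b 2] u))

/-- The operator T u = i^{m−1}(a₁ e₁ ∂₁^m u + a₂ e₂ ∂₂^m u + a₃ e₃ ∂₃^m u). -/
def Tq (Ω : Set E3) (m : ℕ) (a : Fin 3 → E3 → ℝ) (u : E3 → CH) : E3 → CH :=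
  fun x => Ci^[m-1] (∑ l : Fin 3, a l x • lmul (qe l) ((pdW Ω l)^[m] u x))

/-- The operator Q_s(T) u = T(T u) − 2 Re(s) T u + |s|² u. -/
def Qq (Ω : Set E3) (m : ℕ) (a : Fin 3 → E3 → ℝ) (s : HQ) (u : E3 → CH) : E3 → CH :=
  fun x => Tq Ω m a (Tq Ω m a u) x - (2 * s.re) • Tq Ω m a u x + ‖s‖ ^ 2 • u x

/-- The ℍ-valued L² pairing ⟨u,v⟩_{L²} = ∫_Ω ⟨u(x),v(x)⟩ dx. -/
def qL2ip (Ω : Set E3) (u v : E3 → CH) : HQ := ∫ x in Ω, qip (u x) (v x)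

/-- Squared L² norm ‖u‖²_{L²} = ∫_Ω |u(x)|² dx. -/
def L2nsq (Ω : Set E3) (u : E3 → CH) : ℝ := ∫ x in Ω, qmodSq (u x)

/-- Squared L² norm for real-valued functions. -/
def L2nsqR (Ω : Set E3) (u : E3 → ℝ) : ℝ := ∫ x in Ω, (u x) ^ 2

/-- Squared D^m seminorm ‖u‖²_{D^m} = Σ_l ‖∂_{x_l}^m u‖²_{L²}. -/
def DmNsq (Ω : Set E3) (m : ℕ) (u : E3 → CH) : ℝ :=
  ∑ l : Fin 3, L2nsq Ω ((pdW Ω l)^[m] u)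

/-- Squared D^m seminorm for real-valued functions. -/
def DmNsqR (Ω : Set E3) (m : ℕ) (u : E3 → ℝ) : ℝ :=
  ∑ l : Fin 3, L2nsqR Ω ((pdWR Ω l)^[m] u)

/-- The finite set of multi-indices b ∈ ℕ³ with |b| ≤ m. -/
def multiIdxLe (m : ℕ) : Finset (Fin 3 → ℕ) :=
  (Fintype.piFinset fun _ : Fin 3 => Finset.range (m+1)).filter (fun b => b 0 + b 1 + b 2 ≤ m)

/-- The finite set of multi-indices b ∈ ℕ³ with |b| = m. -/
def multiIdxEq (m : ℕ) : Finset (Fin 3 → ℕ) :=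
  (Fintype.piFinset fun _ : Fin 3 => Finset.range (m+1)).filter (fun b => b 0 + b 1 + b 2 = m)

/-- Squared H^m norm ‖u‖²_{H^m} = Σ_{|b| ≤ m} ‖∂^b u‖²_{L²}. -/
def HmNsq (Ω : Set E3) (m : ℕ) (u : E3 → CH) : ℝ :=
  ∑ b ∈ multiIdxLe m, L2nsq Ω (pdMulti Ω b u)

/-- Squared H^m norm for real-valued functions. -/
def HmNsqR (Ω : Set E3) (m : ℕ) (u : E3 → ℝ) : ℝ :=
  ∑ b ∈ multiIdxLe m, L2nsqR Ω (pdMultiR Ω b u)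

/-- u ∈ C_c^∞(Ω, ℂ⊗ℍ). -/
def IsTestFun (Ω : Set E3) (u : E3 → CH) : Prop :=
  ContDiff ℝ (⊤ : ℕ∞) u ∧ HasCompactSupport u ∧ tsupport u ⊆ Ω

/-- u ∈ C_c^∞(Ω, ℝ). -/
def IsTestFunR (Ω : Set E3) (u : E3 → ℝ) : Prop :=
  ContDiff ℝ (⊤ : ℕ∞) u ∧ HasCompactSupport u ∧ tsupport u ⊆ Ω

/-- C is a Poincaré constant for Ω : ‖v‖_{L²} ≤ C ‖∇v‖_{L²} for all real test functions. -/
def IsPoincareConst (Ω : Set E3) (C : ℝ) : Prop :=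
  ∀ v : E3 → ℝ, IsTestFunR Ω v →
    Real.sqrt (∫ x in Ω, (v x) ^ 2) ≤ C * Real.sqrt (∫ x in Ω, ‖gradient v x‖ ^ 2)

/-- The coefficients a₁, a₂, a₃ are of class C^m on Ω, with a_l and all partial
derivatives of a_l of order ≤ m bounded on Ω. -/
def GoodCoeff (Ω : Set E3) (m : ℕ) (a : Fin 3 → E3 → ℝ) : Prop :=
  ∀ l : Fin 3, ContDiffOn ℝ m (a l) Ω ∧
    ∀ b ∈ multiIdxLe m, ∃ B : ℝ, ∀ x ∈ Ω, |pdMultiR Ω b (a l) x| ≤ B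

/-- Ω has property (R) with respect to the point P ∉ closure(Ω) : every ray from P
meets Ω in either the empty set or an open half-line. -/
def HasPropertyR (Ω : Set E3) (P : E3) : Prop :=
  P ∉ closure Ω ∧
    ∀ ω : E3, ‖ω‖ = 1 →
      (∀ r : ℝ, 0 ≤ r → P + r • ω ∉ Ω) ∨
      (∃ r₀ : ℝ, 0 ≤ r₀ ∧ ∀ r : ℝ, 0 ≤ r → (P + r • ω ∈ Ω ↔ r₀ < r))

/-- φ is a weight function for Ω with rate of exponential decay lam relative to P :
φ ∈ C¹(Ω) is bounded and positive, and (d/dr)[r²φ(P+rω)] ≤ −lam·r²φ(P+rω) along every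
ray from P. -/
def IsWeightFun (Ω : Set E3) (P : E3) (φ : E3 → ℝ) (lam : ℝ) : Prop :=
  ContDiffOn ℝ 1 φ Ω ∧ (∃ B : ℝ, ∀ x ∈ Ω, φ x ≤ B) ∧ (∀ x ∈ Ω, 0 < φ x) ∧
    ∀ ω : E3, ‖ω‖ = 1 → ∀ r : ℝ, 0 < r → P + r • ω ∈ Ω →
      deriv (fun t : ℝ => t ^ 2 * φ (P + t • ω)) r ≤ -lam * (r ^ 2 * φ (P + r • ω))

/-- `f` is of class `C^n` with compact support contained in `Ω`. -/
def IsCompactSuppDiff (Ω : Set E3) (n : ℕ) (f : E3 → CH) : Prop :=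
  ContDiff ℝ n f ∧ HasCompactSupport f ∧ tsupport f ⊆ Ω

namespace IsCompactSuppDiff

variable {Ω : Set E3} {n : ℕ} {f g : E3 → CH}

theorem of_isTestFun (hf : IsTestFun Ω f) (n : ℕ) : IsCompactSuppDiff Ω n f :=
  ⟨hf.1.of_le (by exact_mod_cast le_top), hf.2⟩

theorem mono {k : ℕ} (hf : IsCompactSuppDiff Ω n f) (hk : k ≤ n) : IsCompactSuppDiff Ω k f :=
  ⟨hf.1.of_le (by exact_mod_cast hk), hf.2⟩

theorem continuous (hf : IsCompactSuppDiff Ω n f) : Continuous f := hf.1.continuous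

theorem eq_zero (hf : IsCompactSuppDiff Ω n f) {x : E3} (hx : x ∉ Ω) : f x = 0 :=
  image_eq_zero_of_notMem_tsupport fun h => hx (hf.2.2 h)

theorem add (hf : IsCompactSuppDiff Ω n f) (hg : IsCompactSuppDiff Ω n g) :
    IsCompactSuppDiff Ω n (f + g) :=
  ⟨hf.1.add hg.1, hf.2.1.add hg.2.1,
    (tsupport_add f g).trans (Set.union_subset hf.2.2 hg.2.2)⟩

theorem sum {ι : Type*} (s : Finset ι) {F : ι → E3 → CH}
    (hF : ∀ i ∈ s, IsCompactSuppDiff Ω n (F i)) : IsCompactSuppDiff Ω n (∑ i ∈ s, F i) := by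
  classical
  induction s using Finset.induction_on with
  | empty =>
    simp only [Finset.sum_empty]
    refine ⟨contDiff_zero_fun, HasCompactSupport.zero, ?_⟩
    simp [tsupport]
  | insert i s hi ih =>
    rw [Finset.sum_insert hi]
    exact (hF i (by simp)).add (ih fun j hj => hF j (by simp [hj]))

theorem clm_comp (hf : IsCompactSuppDiff Ω n f) (L : CH →L[ℝ] CH) :
    IsCompactSuppDiff Ω n (fun x => L (f x)) :=
  ⟨hf.1.continuousLinearMap_comp L, hf.2.1.comp_left (g := L) (map_zero L),
    (tsupport_comp_subset (g := L) (map_zero L) f).trans hf.2.2⟩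

theorem smul (hΩ : IsOpen Ω) (hf : IsCompactSuppDiff Ω n f) {c : E3 → ℝ}
    (hc : ContDiffOn ℝ n c Ω) : IsCompactSuppDiff Ω n (fun x => c x • f x) := by
  have hsub : tsupport (fun x => c x • f x) ⊆ tsupport f := tsupport_smul_subset_right c f
  refine ⟨?_, hf.2.1.of_isClosed_subset (isClosed_tsupport _) hsub, hsub.trans hf.2.2⟩
  refine contDiff_iff_contDiffAt.2 fun x => ?_
  by_cases hx : x ∈ Ω
  · exact (hc.contDiffAt (hΩ.mem_nhds hx)).smul hf.1.contDiffAt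
  · have h0 : f =ᶠ[nhds x] 0 := notMem_tsupport_iff_eventuallyEq.1 fun h => hx (hf.2.2 h)
    refine (contDiffAt_const (c := (0 : CH))).congr_of_eventuallyEq ?_
    filter_upwards [h0] with y hy
    simp [hy]

theorem pdW_eq (hΩ : IsOpen Ω) (hf : IsCompactSuppDiff Ω n f) (l : Fin 3) :
    pdW Ω l f = fun x => fderiv ℝ f x (EuclideanSpace.single l 1) := by
  funext x
  unfold pdW
  by_cases hx : x ∈ Ω
  · rw [fderivWithin_of_isOpen hΩ hx]
  · have h0 : f =ᶠ[nhds x] 0 := notMem_tsupport_iff_eventuallyEq.1 fun h => hx (hf.2.2 h)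
    have hd : HasFDerivAt f (0 : E3 →L[ℝ] CH) x :=
      (hasFDerivAt_const (0 : CH) x).congr_of_eventuallyEq h0
    rw [hd.fderiv, fderivWithin, if_pos hd.hasFDerivWithinAt]

theorem pdW (hΩ : IsOpen Ω) (hf : IsCompactSuppDiff Ω (n + 1) f) (l : Fin 3) :
    IsCompactSuppDiff Ω n (pdW Ω l f) := by
  rw [hf.pdW_eq hΩ l]
  exact ⟨(hf.1.fderiv_right (m := n) (by norm_cast)).clm_apply contDiff_const,
    hf.2.1.fderiv_apply ℝ _, (tsupport_fderiv_apply_subset ℝ _).trans hf.2.2⟩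

theorem iterate_pdW (hΩ : IsOpen Ω) (l : Fin 3) (k : ℕ) :
    ∀ {f : E3 → CH}, IsCompactSuppDiff Ω (n + k) f →
      IsCompactSuppDiff Ω n ((_root_.pdW Ω l)^[k] f) := by
  induction k with
  | zero => exact fun hf => hf
  | succ k ih => exact fun hf => ih (IsCompactSuppDiff.pdW hΩ hf l)

theorem pdMulti (hΩ : IsOpen Ω) (b : Fin 3 → ℕ) (hf : IsTestFun Ω f) :
    IsCompactSuppDiff Ω 0 (pdMulti Ω b f) :=
  iterate_pdW hΩ 0 _ (iterate_pdW hΩ 1 _ (iterate_pdW hΩ 2 _ (of_isTestFun hf _)))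

theorem pdW_add (hΩ : IsOpen Ω) (hf : IsCompactSuppDiff Ω (n + 1) f)
    (hg : IsCompactSuppDiff Ω (n + 1) g) (l : Fin 3) :
    _root_.pdW Ω l (f + g) = _root_.pdW Ω l f + _root_.pdW Ω l g := by
  rw [(hf.add hg).pdW_eq hΩ, hf.pdW_eq hΩ, hg.pdW_eq hΩ]
  funext x
  rw [fderiv_add (hf.1.differentiable (by simp) x) (hg.1.differentiable (by simp) x)]
  rfl

theorem iterate_pdW_add (hΩ : IsOpen Ω) (l : Fin 3) (k : ℕ) :
    ∀ {f g : E3 → CH}, IsCompactSuppDiff Ω k f → IsCompactSuppDiff Ω k g →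
      (_root_.pdW Ω l)^[k] (f + g) = (_root_.pdW Ω l)^[k] f + (_root_.pdW Ω l)^[k] g := by
  induction k with
  | zero => exact fun _ _ => rfl
  | succ k ih =>
    intro f g hf hg
    simp only [Function.iterate_succ_apply]
    rw [pdW_add hΩ hf hg, ih (IsCompactSuppDiff.pdW hΩ hf l) (IsCompactSuppDiff.pdW hΩ hg l)]

theorem pdW_smul (hΩ : IsOpen Ω) (hf : IsCompactSuppDiff Ω (n + 1) f) {c : E3 → ℝ}
    (hc : ContDiffOn ℝ (n + 1 : ℕ) c Ω) (l : Fin 3) :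
    _root_.pdW Ω l (fun x => c x • f x) =
      (fun x => pdWR Ω l c x • f x) + fun x => c x • _root_.pdW Ω l f x := by
  funext x
  by_cases hx : x ∈ Ω
  · have hcx : DifferentiableAt ℝ c x :=
      (hc.contDiffAt (hΩ.mem_nhds hx)).differentiableAt (by simp)
    have hfx : DifferentiableAt ℝ f x := hf.1.differentiable (by simp) x
    simp only [_root_.pdW, pdWR, Pi.add_apply, fderivWithin_of_isOpen hΩ hx]
    rw [show (fun x => c x • f x) = c • f from rfl, fderiv_smul hcx hfx]
    simp [add_comm]
  · have h1 := IsCompactSuppDiff.pdW hΩ (hf.smul hΩ hc) l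
    have h2 := IsCompactSuppDiff.pdW hΩ hf l
    simp [h1.eq_zero hx, h2.eq_zero hx, hf.eq_zero hx]

end IsCompactSuppDiff

theorem contDiffOn_pdWR {Ω : Set E3} (hΩ : IsOpen Ω) {n : ℕ} {c : E3 → ℝ}
    (hc : ContDiffOn ℝ (n + 1 : ℕ) c Ω) (l : Fin 3) : ContDiffOn ℝ n (pdWR Ω l c) Ω :=
  (hc.fderivWithin hΩ.uniqueDiffOn (m := n) (by norm_cast)).clm_apply contDiffOn_const

/-- A Leibniz-type bound for the iterated partial derivative of a product. -/
theorem norm_iterate_pdW_smul_le {Ω : Set E3} (hΩ : IsOpen Ω) (l : Fin 3) (B : ℝ) (n : ℕ) :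
    ∀ {c : E3 → ℝ} {f : E3 → CH} {x : E3} {S : ℝ}, ContDiffOn ℝ n c Ω → IsCompactSuppDiff Ω n f →
      0 ≤ B → (∀ k ≤ n, |(pdWR Ω l)^[k] c x| ≤ B) → (∀ k ≤ n, ‖(pdW Ω l)^[k] f x‖ ≤ S) →
      ‖(pdW Ω l)^[n] (fun y => c y • f y) x‖ ≤ 2 ^ n * (B * S) := by
  induction n with
  | zero =>
    intro c f x S _ _ hB hcB hfS
    simpa [norm_smul] using
      mul_le_mul (hcB 0 le_rfl) (hfS 0 le_rfl) (norm_nonneg _) hB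
  | succ n ih =>
    intro c f x S hc hf hB hcB hfS
    have hc' := contDiffOn_pdWR hΩ hc l
    have hcn : ContDiffOn ℝ n c Ω := hc.of_le (by norm_cast; omega)
    have hfn := hf.mono n.le_succ
    have hf' := IsCompactSuppDiff.pdW hΩ hf l
    rw [Function.iterate_succ_apply, hf.pdW_smul hΩ hc l,
      IsCompactSuppDiff.iterate_pdW_add hΩ l n (hfn.smul hΩ hc') (hf'.smul hΩ hcn)]
    have h1 := ih (x := x) (S := S) hc' hfn hB (fun k hk => hcB (k + 1) (by omega))
      (fun k hk => hfS k (by omega))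
    have h2 := ih (x := x) (S := S) hcn hf' hB (fun k hk => hcB k (by omega))
      (fun k hk => hfS (k + 1) (by omega))
    calc _ ≤ _ := norm_add_le _ _
      _ ≤ 2 ^ n * (B * S) + 2 ^ n * (B * S) := add_le_add h1 h2
      _ = _ := by ring

theorem integrable_bilinear {Ω : Set E3} {n k : ℕ} {f g : E3 → CH}
    (hf : IsCompactSuppDiff Ω n f) (hg : IsCompactSuppDiff Ω k g) (B : CH →L[ℝ] CH →L[ℝ] HQ) :
    Integrable (fun x => B (f x) (g x)) := by
  refine Continuous.integrable_of_hasCompactSupport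
    ((B.continuous.comp hf.continuous).clm_apply hg.continuous) ?_
  refine hf.2.1.mono fun x hx => ?_
  contrapose! hx
  simp only [Function.mem_support, not_not] at hx ⊢
  simp [hx]

theorem setIntegral_bilinear {Ω : Set E3} {n : ℕ} {f : E3 → CH}
    (hf : IsCompactSuppDiff Ω n f) (g : E3 → CH) (B : CH →L[ℝ] CH →L[ℝ] HQ) :
    ∫ x in Ω, B (f x) (g x) = ∫ x, B (f x) (g x) :=
  setIntegral_eq_integral_of_forall_compl_eq_zero fun x hx => by simp [hf.eq_zero hx]

theorem integral_bilinear_pdW {Ω : Set E3} (hΩ : IsOpen Ω) (B : CH →L[ℝ] CH →L[ℝ] HQ)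
    (l : Fin 3) {n k : ℕ} {f g : E3 → CH} (hf : IsCompactSuppDiff Ω (n + 1) f)
    (hg : IsCompactSuppDiff Ω (k + 1) g) :
    ∫ x, B (pdW Ω l f x) (g x) = -∫ x, B (f x) (pdW Ω l g x) := by
  have h1 := integrable_bilinear (hf.pdW hΩ l) hg B
  have h2 := integrable_bilinear hf (hg.pdW hΩ l) B
  rw [hf.pdW_eq hΩ] at h1 ⊢
  rw [hg.pdW_eq hΩ] at h2 ⊢
  rw [integral_bilinear_fderiv_right_eq_neg_left_of_integrable h1 h2
    (integrable_bilinear hf hg B) (fun x _ => hf.1.differentiable (by simp) x)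
    (fun x _ => hg.1.differentiable (by simp) x), neg_neg]

theorem integral_bilinear_iterate_pdW {Ω : Set E3} (hΩ : IsOpen Ω) (B : CH →L[ℝ] CH →L[ℝ] HQ)
    (l : Fin 3) (n : ℕ) : ∀ {f g : E3 → CH}, IsCompactSuppDiff Ω n f →
      IsCompactSuppDiff Ω n g →
      ∫ x, B ((pdW Ω l)^[n] f x) (g x) = (-1 : ℝ) ^ n • ∫ x, B (f x) ((pdW Ω l)^[n] g x) := by
  induction n with
  | zero => intro f g _ _; simp
  | succ n ih =>
    intro f g hf hg
    have hgn : IsCompactSuppDiff Ω 1 ((pdW Ω l)^[n] g) :=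
      IsCompactSuppDiff.iterate_pdW hΩ l n (by rwa [add_comm])
    rw [Function.iterate_succ_apply, ih (hf.pdW hΩ l) (hg.mono n.le_succ),
      integral_bilinear_pdW hΩ B l hf (k := 0) hgn, Function.iterate_succ_apply', pow_succ]
    simp

/-- `Ci` as a linear map. -/
def CiL : CH →ₗ[ℝ] CH where
  toFun := Ci
  map_add' u v := by ext <;> simp [Ci] <;> ring
  map_smul' c u := by ext <;> simp [Ci]

/-- `lmul p` as a linear map. -/
def lmulL (p : HQ) : CH →ₗ[ℝ] CH where
  toFun := lmul p
  map_add' u v := by simp [lmul, mul_add]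
  map_smul' c u := by simp [lmul]

theorem iterate_Ci (k : ℕ) (u : CH) : Ci^[k] u = (CiL ^ k) u := by
  rw [Module.End.pow_apply]
  rfl

theorem norm_Ci (u : CH) : ‖Ci u‖ = ‖u‖ := by
  simp [Ci, Prod.norm_def, max_comm]

theorem norm_iterate_Ci (k : ℕ) (u : CH) : ‖Ci^[k] u‖ = ‖u‖ := by
  induction k generalizing u with
  | zero => rfl
  | succ k ih => rw [Function.iterate_succ_apply, ih, norm_Ci]

theorem norm_qe (l : Fin 3) : ‖qe l‖ = 1 := by
  have h : ‖qe l‖ * ‖qe l‖ = 1 := by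
    rw [← Quaternion.normSq_eq_norm_mul_self, Quaternion.normSq_def']
    fin_cases l <;> simp [qe]
  nlinarith [norm_nonneg (qe l)]

theorem norm_lmul_qe (l : Fin 3) (u : CH) : ‖lmul (qe l) u‖ = ‖u‖ := by
  simp [lmul, Prod.norm_def, norm_qe]

theorem norm_qip_le (u v : CH) : ‖qip u v‖ ≤ 2 * ‖u‖ * ‖v‖ := by
  have h1 : ‖star u.1 * v.1‖ ≤ ‖u‖ * ‖v‖ := by
    rw [norm_mul, norm_star]
    exact mul_le_mul (norm_fst_le u) (norm_fst_le v) (norm_nonneg _) (norm_nonneg _)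
  have h2 : ‖star u.2 * v.2‖ ≤ ‖u‖ * ‖v‖ := by
    rw [norm_mul, norm_star]
    exact mul_le_mul (norm_snd_le u) (norm_snd_le v) (norm_nonneg _) (norm_nonneg _)
  calc ‖qip u v‖ ≤ _ := norm_add_le _ _
    _ ≤ ‖u‖ * ‖v‖ + ‖u‖ * ‖v‖ := add_le_add h1 h2
    _ = _ := by ring

/-- The pairing `qip` as a continuous real bilinear map. -/
def qipL : CH →L[ℝ] CH →L[ℝ] HQ :=
  LinearMap.mkContinuous₂
    (LinearMap.mk₂ ℝ qip
      (fun u u' v => by simp only [qip, Prod.fst_add, Prod.snd_add, star_add, add_mul]; abel)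
      (fun c u v => by simp [qip])
      (fun u v v' => by simp only [qip, Prod.fst_add, Prod.snd_add, mul_add]; abel)
      (fun c u v => by simp [qip]))
    2 norm_qip_le

theorem qipL_apply (u v : CH) : qipL u v = qip u v := rfl

/-- The order-zero symbol `u ↦ i^k e_l u` of the `l`-th summand of `T`. -/
def unitL (k : ℕ) (l : Fin 3) : CH →L[ℝ] CH :=
  LinearMap.toContinuousLinearMap ((CiL ^ k) ∘ₗ lmulL (qe l))

theorem unitL_apply (k : ℕ) (l : Fin 3) (u : CH) : unitL k l u = Ci^[k] (lmul (qe l) u) := by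
  rw [iterate_Ci]
  rfl

theorem norm_unitL (k : ℕ) (l : Fin 3) (u : CH) : ‖unitL k l u‖ = ‖u‖ := by
  rw [unitL_apply, norm_iterate_Ci, norm_lmul_qe]

theorem Tq_eq (Ω : Set E3) (m : ℕ) (a : Fin 3 → E3 → ℝ) (u : E3 → CH) :
    Tq Ω m a u = ∑ l, fun x => unitL (m - 1) l (a l x • (pdW Ω l)^[m] u x) := by
  funext x
  simp only [Tq, iterate_Ci, map_sum, map_smul, Finset.sum_apply, unitL_apply]

theorem IsCompactSuppDiff.Tq {Ω : Set E3} (hΩ : IsOpen Ω) {n m : ℕ} {a : Fin 3 → E3 → ℝ}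
    (ha : ∀ l, ContDiffOn ℝ n (a l) Ω) {u : E3 → CH} (hu : IsCompactSuppDiff Ω (n + m) u) :
    IsCompactSuppDiff Ω n (Tq Ω m a u) := by
  rw [Tq_eq]
  exact IsCompactSuppDiff.sum _ fun l _ =>
    ((IsCompactSuppDiff.iterate_pdW hΩ l m hu).smul hΩ (ha l)).clm_comp _

/-- The pointwise sum of the moduli of all partial derivatives of order at most `m`. -/
def derivSum (Ω : Set E3) (m : ℕ) (u : E3 → CH) (x : E3) : ℝ :=
  ∑ b ∈ multiIdxLe m, ‖pdMulti Ω b u x‖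

theorem derivSum_nonneg (Ω : Set E3) (m : ℕ) (u : E3 → CH) (x : E3) : 0 ≤ derivSum Ω m u x :=
  Finset.sum_nonneg fun _ _ => norm_nonneg _

theorem single_mem_multiIdxLe {m k : ℕ} (hk : k ≤ m) (l : Fin 3) :
    Pi.single l k ∈ multiIdxLe m := by
  simp only [multiIdxLe, Finset.mem_filter, Fintype.mem_piFinset, Finset.mem_range]
  refine ⟨fun i => ?_, ?_⟩
  · by_cases h : i = l
    · subst h; simp; omega
    · simp [h]
  · fin_cases l <;> simpa [Pi.single_apply] using hk

theorem pdMulti_single (Ω : Set E3) (l : Fin 3) (k : ℕ) (u : E3 → CH) :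
    pdMulti Ω (Pi.single l k) u = (pdW Ω l)^[k] u := by
  fin_cases l <;> simp [pdMulti]

theorem pdMultiR_single (Ω : Set E3) (l : Fin 3) (k : ℕ) (c : E3 → ℝ) :
    pdMultiR Ω (Pi.single l k) c = (pdWR Ω l)^[k] c := by
  fin_cases l <;> simp [pdMultiR]

theorem norm_iterate_pdW_le_derivSum (Ω : Set E3) {m k : ℕ} (hk : k ≤ m) (l : Fin 3)
    (u : E3 → CH) (x : E3) : ‖(pdW Ω l)^[k] u x‖ ≤ derivSum Ω m u x := by
  rw [← pdMulti_single]
  exact Finset.single_le_sum (f := fun b => ‖pdMulti Ω b u x‖) (fun _ _ => norm_nonneg _)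
    (single_mem_multiIdxLe hk l)

theorem norm_Tq_le {Ω : Set E3} {m : ℕ} {a : Fin 3 → E3 → ℝ} {B : ℝ} {x : E3}
    (ha : ∀ l, |a l x| ≤ B) (u : E3 → CH) : ‖Tq Ω m a u x‖ ≤ 3 * (B * derivSum Ω m u x) := by
  rw [Tq_eq, Finset.sum_apply]
  calc _ ≤ ∑ l : Fin 3, B * derivSum Ω m u x := norm_sum_le_of_le _ fun l _ => ?_
    _ = _ := by simp
  rw [norm_unitL, norm_smul]
  exact mul_le_mul (ha l) (norm_iterate_pdW_le_derivSum Ω le_rfl l u x) (norm_nonneg _)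
    ((abs_nonneg _).trans (ha l))

section TestFunctions

variable {Ω : Set E3} {m : ℕ} {u v : E3 → CH}

theorem continuous_derivSum (hΩ : IsOpen Ω) (hu : IsTestFun Ω u) :
    Continuous (derivSum Ω m u) :=
  continuous_finsetSum _ fun b _ => (IsCompactSuppDiff.pdMulti hΩ b hu).continuous.norm

theorem hasCompactSupport_derivSum (hΩ : IsOpen Ω) (hu : IsTestFun Ω u) :
    HasCompactSupport (derivSum Ω m u) := by
  have h : HasCompactSupport (∑ b ∈ multiIdxLe m, fun x => ‖pdMulti Ω b u x‖) := by
    refine Finset.sum_induction _ HasCompactSupport (fun _ _ => HasCompactSupport.add)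
      HasCompactSupport.zero fun b _ => (IsCompactSuppDiff.pdMulti hΩ b hu).2.1.norm
  convert h using 1
  funext x
  simp [derivSum]

theorem sq_norm_le_qmodSq (u : CH) : ‖u‖ ^ 2 ≤ qmodSq u := by
  unfold qmodSq
  rcases max_choice ‖u.1‖ ‖u.2‖ with h | h <;> rw [Prod.norm_def, h] <;>
    nlinarith [sq_nonneg ‖u.1‖, sq_nonneg ‖u.2‖]

theorem integral_sq_derivSum_le (hΩ : IsOpen Ω) (hu : IsTestFun Ω u) :
    ∫ x in Ω, derivSum Ω m u x ^ 2 ≤ #(multiIdxLe m) * HmNsq Ω m u := by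
  have hint : ∀ b ∈ multiIdxLe m, Integrable (fun x => qmodSq (pdMulti Ω b u x))
      (volume.restrict Ω) := fun b _ => by
    have hb := IsCompactSuppDiff.pdMulti hΩ b hu
    refine (Continuous.integrable_of_hasCompactSupport ?_
      (hb.2.1.comp_left (g := qmodSq) (by simp [qmodSq]))).restrict
    have := hb.continuous
    unfold qmodSq
    fun_prop
  unfold HmNsq L2nsq
  rw [← integral_finsetSum _ hint, ← integral_const_mul]
  refine integral_mono_of_nonneg (Filter.Eventually.of_forall fun x => sq_nonneg _)
    ((integrable_finsetSum _ hint).const_mul _) (Filter.Eventually.of_forall fun x => ?_)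
  refine sq_sum_le_card_mul_sum_sq.trans ?_
  exact mul_le_mul_of_nonneg_left (Finset.sum_le_sum fun b _ => sq_norm_le_qmodSq _)
    (Nat.cast_nonneg _)

theorem integral_derivSum_mul_le (hΩ : IsOpen Ω) (hu : IsTestFun Ω u) (hv : IsTestFun Ω v) :
    ∫ x in Ω, derivSum Ω m u x * derivSum Ω m v x ≤
      #(multiIdxLe m) * Real.sqrt (HmNsq Ω m u) * Real.sqrt (HmNsq Ω m v) := by
  have hL : ∀ {w : E3 → CH}, IsTestFun Ω w →
      MemLp (derivSum Ω m w) (ENNReal.ofReal 2) (volume.restrict Ω) := fun hw =>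
    ((continuous_derivSum hΩ hw).memLp_of_hasCompactSupport
      (hasCompactSupport_derivSum hΩ hw)).restrict Ω
  have h := integral_mul_le_Lp_mul_Lq_of_nonneg (μ := volume.restrict Ω)
    Real.HolderConjugate.two_two
    (Filter.Eventually.of_forall (derivSum_nonneg Ω m u))
    (Filter.Eventually.of_forall (derivSum_nonneg Ω m v)) (hL hu) (hL hv)
  simp only [Real.rpow_two, ← Real.sqrt_eq_rpow] at h
  have hN : (0 : ℝ) ≤ #(multiIdxLe m) := Nat.cast_nonneg _
  calc _ ≤ _ := h
    _ ≤ Real.sqrt (#(multiIdxLe m) * HmNsq Ω m u) * Real.sqrt (#(multiIdxLe m) * HmNsq Ω m v) := by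
      gcongr
      · exact integral_sq_derivSum_le hΩ hu
      · exact integral_sq_derivSum_le hΩ hv
    _ = _ := by
      rw [Real.sqrt_mul hN, Real.sqrt_mul hN]
      linear_combination Real.sqrt (HmNsq Ω m u) * Real.sqrt (HmNsq Ω m v) * Real.mul_self_sqrt hN

theorem norm_setIntegral_le_derivSum (hΩ : IsOpen Ω) (hu : IsTestFun Ω u) (hv : IsTestFun Ω v)
    {F : E3 → HQ} {K : ℝ} (hF : ∀ x ∈ Ω, ‖F x‖ ≤ K * (derivSum Ω m u x * derivSum Ω m v x)) :
    ‖∫ x in Ω, F x‖ ≤ K * ∫ x in Ω, derivSum Ω m u x * derivSum Ω m v x := by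
  rw [← integral_const_mul]
  refine norm_integral_le_of_norm_le (Integrable.const_mul ?_ K) ?_
  · have hc := (continuous_derivSum (m := m) hΩ hu).mul (continuous_derivSum (m := m) hΩ hv)
    exact (hc.integrable_of_hasCompactSupport
      (hasCompactSupport_derivSum hΩ hu).mul_right).restrict
  · exact (ae_restrict_iff' hΩ.measurableSet).2 (Filter.Eventually.of_forall hF)

end TestFunctions

theorem GoodCoeff.exists_bound {Ω : Set E3} {m : ℕ} {a : Fin 3 → E3 → ℝ} (ha : GoodCoeff Ω m a) :
    ∃ B : ℝ, 0 ≤ B ∧ ∀ l, ∀ k ≤ m, ∀ x ∈ Ω, |(pdWR Ω l)^[k] (a l) x| ≤ B := by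
  have h : ∀ l : Fin 3, ∀ k : ℕ, ∃ B : ℝ, k ≤ m → ∀ x ∈ Ω, |(pdWR Ω l)^[k] (a l) x| ≤ B := by
    intro l k
    by_cases hk : k ≤ m
    · obtain ⟨B, hB⟩ := (ha l).2 _ (single_mem_multiIdxLe hk l)
      rw [pdMultiR_single] at hB
      exact ⟨B, fun _ => hB⟩
    · exact ⟨0, fun h => absurd h hk⟩
  choose B hB using h
  refine ⟨∑ l, ∑ k ∈ Finset.range (m + 1), |B l k|, by positivity, fun l k hk x hx => ?_⟩
  calc _ ≤ B l k := hB l k hk x hx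
    _ ≤ |B l k| := le_abs_self _
    _ ≤ ∑ k ∈ Finset.range (m + 1), |B l k| :=
      Finset.single_le_sum (f := fun k => |B l k|) (fun _ _ => abs_nonneg _)
        (Finset.mem_range.2 (by omega))
    _ ≤ _ := Finset.single_le_sum (f := fun l => ∑ k ∈ Finset.range (m + 1), |B l k|)
        (fun _ _ => by positivity) (Finset.mem_univ l)

/-- The bound for the second-order term `⟨T (T u), v⟩_{L²}`, obtained by moving the outer
derivatives to `v`. -/
theorem norm_integral_qip_Tq_Tq_le {Ω : Set E3} (hΩ : IsOpen Ω) {m : ℕ} {a : Fin 3 → E3 → ℝ}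
    (ha : ∀ l, ContDiffOn ℝ m (a l) Ω) {B : ℝ} (hB : 0 ≤ B)
    (haB : ∀ l, ∀ k ≤ m, ∀ x ∈ Ω, |(pdWR Ω l)^[k] (a l) x| ≤ B) {u v : E3 → CH}
    (hu : IsTestFun Ω u) (hv : IsTestFun Ω v) :
    ‖∫ x in Ω, qip (Tq Ω m a (Tq Ω m a u) x) (v x)‖ ≤
      18 * 2 ^ m * B ^ 2 * ∫ x in Ω, derivSum Ω m u x * derivSum Ω m v x := by
  set w := Tq Ω m a u
  have hw : IsCompactSuppDiff Ω m w := IsCompactSuppDiff.Tq hΩ ha (.of_isTestFun hu _)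
  have hw0 : ∀ l, IsCompactSuppDiff Ω 0 ((pdW Ω l)^[m] w) := fun l =>
    IsCompactSuppDiff.iterate_pdW hΩ l m (by rwa [zero_add])
  have hav : ∀ l, IsCompactSuppDiff Ω m (fun x => a l x • v x) := fun l =>
    IsCompactSuppDiff.smul hΩ (.of_isTestFun hv m) (ha l)
  have hsplit : ∀ x, qip (Tq Ω m a w x) (v x) =
      ∑ l, (qipL ∘L unitL (m - 1) l) ((pdW Ω l)^[m] w x) (a l x • v x) := fun x => by
    rw [← qipL_apply, Tq_eq, Finset.sum_apply, map_sum, _root_.sum_apply]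
    simp
  simp only [hsplit]
  rw [integral_finsetSum _ fun l _ =>
    (integrable_bilinear (hw0 l) (hav l) (qipL ∘L unitL (m - 1) l)).restrict]
  calc _ ≤ ∑ l : Fin 3, 6 * 2 ^ m * B ^ 2 * ∫ x in Ω, derivSum Ω m u x * derivSum Ω m v x :=
        norm_sum_le_of_le _ fun l _ => ?_
    _ = _ := by simp; ring
  rw [setIntegral_bilinear (hw0 l), integral_bilinear_iterate_pdW hΩ _ l m hw (hav l), norm_smul,
    norm_pow, norm_neg, norm_one, one_pow, one_mul, ← setIntegral_bilinear hw]
  refine norm_setIntegral_le_derivSum hΩ hu hv fun x hx => ?_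
  have h1 := norm_Tq_le (Ω := Ω) (m := m) (a := a) (fun l => haB l 0 m.zero_le x hx) u
  have h2 := norm_iterate_pdW_smul_le hΩ l B m (ha l) (.of_isTestFun hv m) hB
    (fun k hk => haB l k hk x hx) (fun k hk => norm_iterate_pdW_le_derivSum Ω hk l v x)
  calc _ ≤ 2 * ‖unitL (m - 1) l (w x)‖ * ‖(pdW Ω l)^[m] (fun y => a l y • v y) x‖ :=
        norm_qip_le _ _
    _ ≤ 2 * (3 * (B * derivSum Ω m u x)) * (2 ^ m * (B * derivSum Ω m v x)) := by
      rw [norm_unitL]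
      have := derivSum_nonneg Ω m u x
      gcongr
    _ = _ := by ring

/-- continuity of the bilinear form, unbounded case. -/
theorem continuity_unbounded
    (m : ℕ) (hm : 1 ≤ m)
    (Ω : Set E3) (hΩo : IsOpen Ω)
    (a : Fin 3 → E3 → ℝ) (ha : GoodCoeff Ω m a) :
    ∀ s : HQ, ∃ C : ℝ, 0 < C ∧
      ∀ u v : E3 → CH, IsTestFun Ω u → IsTestFun Ω v →
        ‖qL2ip Ω (Qq Ω m a s u) v‖ ≤
          C * Real.sqrt (HmNsq Ω m u) * Real.sqrt (HmNsq Ω m v) := by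
  intro s
  obtain ⟨B, hB, haB⟩ := ha.exists_bound
  set K : ℝ := 18 * 2 ^ m * B ^ 2 + (|2 * s.re| * (6 * B) + ‖s‖ ^ 2 * 2) with hK
  have hK0 : 0 ≤ K := by positivity
  refine ⟨K * #(multiIdxLe m) + 1, by positivity, fun u v hu hv => ?_⟩
  have hac : ∀ l, ContDiffOn ℝ m (a l) Ω := fun l => (ha l).1
  have hT : IsCompactSuppDiff Ω m (Tq Ω m a u) :=
    IsCompactSuppDiff.Tq hΩo hac (.of_isTestFun hu _)
  have hTT : IsCompactSuppDiff Ω 0 (Tq Ω m a (Tq Ω m a u)) :=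
    IsCompactSuppDiff.Tq hΩo (fun l => (hac l).of_le (by norm_cast; omega)) (by rwa [zero_add])
  have hu0 := IsCompactSuppDiff.of_isTestFun hu 0
  have hv0 := IsCompactSuppDiff.of_isTestFun hv 0
  have hsplit : ∀ x, qip (Qq Ω m a s u x) (v x) = qip (Tq Ω m a (Tq Ω m a u) x) (v x) +
      (‖s‖ ^ 2 • qip (u x) (v x) - (2 * s.re) • qip (Tq Ω m a u x) (v x)) := fun x => by
    simp only [← qipL_apply, Qq, map_add, map_sub, map_smul, _root_.add_apply,
      _root_.sub_apply, _root_.smul_apply]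
    abel
  have hlow : ‖∫ x in Ω, (‖s‖ ^ 2 • qip (u x) (v x) - (2 * s.re) • qip (Tq Ω m a u x) (v x))‖ ≤
      (|2 * s.re| * (6 * B) + ‖s‖ ^ 2 * 2) *
        ∫ x in Ω, derivSum Ω m u x * derivSum Ω m v x := by
    refine norm_setIntegral_le_derivSum hΩo hu hv fun x hx => ?_
    have hux : ‖u x‖ ≤ derivSum Ω m u x := norm_iterate_pdW_le_derivSum Ω m.zero_le 0 u x
    have hvx : ‖v x‖ ≤ derivSum Ω m v x := norm_iterate_pdW_le_derivSum Ω m.zero_le 0 v x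
    have hTx := norm_Tq_le (Ω := Ω) (m := m) (a := a) (fun l => haB l 0 m.zero_le x hx) u
    have hSu := derivSum_nonneg Ω m u x
    calc _ ≤ ‖s‖ ^ 2 * ‖qip (u x) (v x)‖ + |2 * s.re| * ‖qip (Tq Ω m a u x) (v x)‖ := by
          refine (norm_sub_le _ _).trans_eq ?_
          rw [norm_smul, norm_smul, norm_pow, norm_norm, Real.norm_eq_abs]
      _ ≤ ‖s‖ ^ 2 * (2 * derivSum Ω m u x * derivSum Ω m v x) +
          |2 * s.re| * (2 * (3 * (B * derivSum Ω m u x)) * derivSum Ω m v x) := by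
        gcongr
        · exact (norm_qip_le _ _).trans (by gcongr)
        · exact (norm_qip_le _ _).trans (by gcongr)
      _ = _ := by ring
  unfold qL2ip
  simp only [hsplit]
  have iTT := (integrable_bilinear hTT hv0 qipL).restrict (s := Ω)
  have iT := (integrable_bilinear hT hv0 qipL).restrict (s := Ω)
  have iu := (integrable_bilinear hu0 hv0 qipL).restrict (s := Ω)
  have hadd : ∫ x in Ω, (qip (Tq Ω m a (Tq Ω m a u) x) (v x) +
      (‖s‖ ^ 2 • qip (u x) (v x) - (2 * s.re) • qip (Tq Ω m a u x) (v x))) = _ :=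
    integral_add iTT ((iu.smul (‖s‖ ^ 2)).sub (iT.smul (2 * s.re)))
  rw [hadd]
  have hmain := norm_integral_qip_Tq_Tq_le hΩo hac hB haB hu hv
  calc _ ≤ _ := norm_add_le _ _
    _ ≤ K * ∫ x in Ω, derivSum Ω m u x * derivSum Ω m v x := by
      rw [hK, add_mul]
      exact add_le_add hmain hlow
    _ ≤ K * (#(multiIdxLe m) * Real.sqrt (HmNsq Ω m u) * Real.sqrt (HmNsq Ω m v)) := by
      gcongr
      exact integral_derivSum_mul_le hΩo hu hv
    _ ≤ _ := by
      have : 0 ≤ Real.sqrt (HmNsq Ω m u) * Real.sqrt (HmNsq Ω m v) := by positivity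
      linarith
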